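/- arXiv:1612.03793 — 2 statements merged into one kernel-verified Lean document; each statement's English description precedes it below -/
import Mathlib

section
/- Let M(λ) ∈ F[λ]^{m×(m+n)} be a polynomial matrix of degree at most d with full row normal rank m, let S_k be its Sylvester matrices, r_k = rank(S_k), n_k = k(m+n) − r_k, and let α_k be the number of right minimal indices of M(λ) equal to k. Then α_0 = m + n − r_1 = n_1 and, for every k ≥ 1, α_k = (n_{k+1} − n_k) − (n_k − n_{k−1}) = (r_k − r_{k−1}) − (r_{k+1} − r_k), where r_0 = n_0 = 0. -/
open Polynomial Matrix

noncomputable section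

variable {F : Type*} [Field F]

/-- The rows of a polynomial matrix, viewed as vectors of rational functions. -/
def ratRow {p q : ℕ} (M : Matrix (Fin p) (Fin q) F[X]) (i : Fin p) :
    Fin q → RatFunc F :=
  fun j => algebraMap F[X] (RatFunc F) (M i j)

/-- The rational vector subspace spanned by the rows of a polynomial matrix. -/
def rowSpan {p q : ℕ} (M : Matrix (Fin p) (Fin q) F[X]) :
    Submodule (RatFunc F) (Fin q → RatFunc F) :=
  Submodule.span (RatFunc F) (Set.range (ratRow M))

/-- The degree of the `i`-th row of a polynomial matrix. -/
def rowDeg {p q : ℕ} (M : Matrix (Fin p) (Fin q) F[X]) (i : Fin p) : ℕ :=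
  Finset.univ.sup fun j => (M i j).natDegree

/-- The rows of `M` form a polynomial basis of the rational subspace `V` whose sum of
row degrees is minimal among all polynomial bases of `V`. -/
def IsMinimalBasisOf {p q : ℕ} (V : Submodule (RatFunc F) (Fin q → RatFunc F))
    (M : Matrix (Fin p) (Fin q) F[X]) : Prop :=
  LinearIndependent (RatFunc F) (ratRow M) ∧ rowSpan M = V ∧
    ∀ M' : Matrix (Fin p) (Fin q) F[X],
      LinearIndependent (RatFunc F) (ratRow M') → rowSpan M' = V →
        ∑ i, rowDeg M i ≤ ∑ i, rowDeg M' i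

/-- A polynomial matrix is a minimal basis if its rows form a minimal basis of the
rational subspace they span. -/
def IsMinimalBasis {p q : ℕ} (M : Matrix (Fin p) (Fin q) F[X]) : Prop :=
  IsMinimalBasisOf (rowSpan M) M

/-- A polynomial matrix viewed as a matrix of rational functions. -/
def ratMat {p q : ℕ} (M : Matrix (Fin p) (Fin q) F[X]) :
    Matrix (Fin p) (Fin q) (RatFunc F) :=
  M.map (algebraMap F[X] (RatFunc F))

/-- The right null-space over `F(λ)` of a polynomial matrix. -/
def rightNullSpace {p q : ℕ} (M : Matrix (Fin p) (Fin q) F[X]) :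
    Submodule (RatFunc F) (Fin q → RatFunc F) :=
  LinearMap.ker (Matrix.mulVecLin (ratMat M))

/-- The `k`-th Sylvester matrix of a polynomial matrix regarded as having degree at
most `e`: the block-Toeplitz matrix with `k` block columns whose `j`-th block column
carries the coefficients `M_0, …, M_e` in block rows `j, …, j+e` and zeros elsewhere. -/
def sylv {p q : ℕ} (e k : ℕ) (M : Matrix (Fin p) (Fin q) F[X]) :
    Matrix (Fin (k + e) × Fin p) (Fin k × Fin q) F :=
  fun r c =>
    if (c.1 : ℕ) ≤ (r.1 : ℕ) ∧ (r.1 : ℕ) ≤ (c.1 : ℕ) + e then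
      (M r.2 c.2).coeff ((r.1 : ℕ) - (c.1 : ℕ))
    else 0

/-- `M`, regarded as a polynomial matrix of degree at most `e`, has
full-Sylvester-rank if every Sylvester matrix `S_k`, `k ≥ 1`, has full rank. -/
def HasFullSylvesterRank {p q : ℕ} (e : ℕ) (M : Matrix (Fin p) (Fin q) F[X]) : Prop :=
  ∀ k : ℕ, 1 ≤ k → (sylv e k M).rank = min ((k + e) * p) (k * q)

/-- The `k`-th coefficient matrix of a polynomial matrix. -/
def coeffMat {p q : ℕ} (k : ℕ) (M : Matrix (Fin p) (Fin q) F[X]) :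
    Matrix (Fin p) (Fin q) F :=
  fun i j => (M i j).coeff k

/-- The highest-row-degree coefficient matrix: its `i`-th row is the coefficient of
`λ^{d_i}` in the `i`-th row of `M`, where `d_i` is the `i`-th row degree. -/
def highRowMat {p q : ℕ} (M : Matrix (Fin p) (Fin q) F[X]) :
    Matrix (Fin p) (Fin q) F :=
  fun i j => (M i j).coeff (rowDeg M i)

/-- The `e`-reversal of a polynomial matrix: `rev_e P(λ) = λ^e P(1/λ)`. -/
def revMat {p q : ℕ} (e : ℕ) (P : Matrix (Fin p) (Fin q) F[X]) :
    Matrix (Fin p) (Fin q) F[X] :=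
  fun i j => (P i j).reflect e


/-- A polynomial vector, viewed as a vector of rational functions. -/
def ratVec {q : ℕ} (y : Fin q → F[X]) : Fin q → RatFunc F :=
  fun j => algebraMap F[X] (RatFunc F) (y j)

lemma ratVec_injective {q : ℕ} :
    Function.Injective (ratVec : (Fin q → F[X]) → Fin q → RatFunc F) := fun _ _ h =>
  funext fun j => IsFractionRing.injective F[X] (RatFunc F) (congrFun h j)

lemma ratVec_smul {q : ℕ} (D : F[X]) (y : Fin q → F[X]) :
    ratVec (D • y) = algebraMap F[X] (RatFunc F) D • ratVec y := by
  ext j; simp [ratVec]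

lemma ratVec_vecMul {p q : ℕ} (c : Fin p → F[X]) (N : Matrix (Fin p) (Fin q) F[X]) :
    ratVec (c ᵥ* N) = ∑ l, algebraMap F[X] (RatFunc F) (c l) • ratRow N l := by
  ext j; simp [ratVec, ratRow, Matrix.vecMul, dotProduct, Algebra.smul_def]

lemma ratVec_mulVec {p q : ℕ} (M : Matrix (Fin p) (Fin q) F[X]) (x : Fin q → F[X]) :
    ratMat M *ᵥ ratVec x = ratVec (M *ᵥ x) := by
  ext i; simp [ratVec, ratMat, Matrix.mulVec, dotProduct]

lemma ratVec_mem_rightNullSpace {p q : ℕ} {M : Matrix (Fin p) (Fin q) F[X]}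
    {x : Fin q → F[X]} : ratVec x ∈ rightNullSpace M ↔ M *ᵥ x = 0 := by
  rw [rightNullSpace, LinearMap.mem_ker, Matrix.mulVecLin_apply, ratVec_mulVec,
    ← ratVec_injective.eq_iff]
  simp [ratVec, funext_iff]

lemma eq_zero_of_vecMul_eq_zero {p q : ℕ} {N : Matrix (Fin p) (Fin q) F[X]}
    (hN : LinearIndependent (RatFunc F) (ratRow N)) {c : Fin p → F[X]} (hc : c ᵥ* N = 0) :
    c = 0 := by
  have h := ratVec_vecMul c N
  rw [hc, show ratVec (0 : Fin q → F[X]) = 0 by ext; simp [ratVec]] at h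
  ext1 l
  simpa using Fintype.linearIndependent_iff.1 hN _ h.symm l

lemma natDegree_le_rowDeg {p q : ℕ} (N : Matrix (Fin p) (Fin q) F[X]) (i : Fin p) (j : Fin q) :
    (N i j).natDegree ≤ rowDeg N i :=
  Finset.le_sup (f := fun j => (N i j).natDegree) (Finset.mem_univ j)

/-- Clearing denominators in the coordinates of a polynomial vector. -/
lemma exists_smul_eq_vecMul {p q : ℕ} {N : Matrix (Fin p) (Fin q) F[X]} {y : Fin q → F[X]}
    (hy : ratVec y ∈ rowSpan N) : ∃ D : F[X], D ≠ 0 ∧ ∃ c : Fin p → F[X], D • y = c ᵥ* N := by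
  obtain ⟨g, hg⟩ := (Submodule.mem_span_range_iff_exists_fun _).1 hy
  obtain ⟨D, hD⟩ := IsLocalization.exist_integer_multiples_of_finite (nonZeroDivisors F[X]) g
  choose c hc using hD
  refine ⟨D, nonZeroDivisors.coe_ne_zero D, c, ratVec_injective ?_⟩
  rw [ratVec_smul, ratVec_vecMul, ← hg, Finset.smul_sum]
  refine Finset.sum_congr rfl fun l _ => ?_
  rw [hc l, smul_smul, Algebra.smul_def (D : F[X]) (g l)]

lemma ratRow_update_self {p q : ℕ} (N : Matrix (Fin p) (Fin q) F[X]) (i : Fin p)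
    (y : Fin q → F[X]) : ratRow (N.updateRow i y) i = ratVec y := by
  ext j; simp [ratRow, ratVec]

lemma ratRow_update_ne {p q : ℕ} (N : Matrix (Fin p) (Fin q) F[X]) {i l : Fin p} (h : l ≠ i)
    (y : Fin q → F[X]) : ratRow (N.updateRow i y) l = ratRow N l := by
  ext j; simp [ratRow, h]

lemma rowDeg_update_ne {p q : ℕ} (N : Matrix (Fin p) (Fin q) F[X]) {i l : Fin p} (h : l ≠ i)
    (y : Fin q → F[X]) : rowDeg (N.updateRow i y) l = rowDeg N l := by
  simp [rowDeg, h]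

/-- Replacing a row by a polynomial vector with nonzero coordinate along it does not change
the row span. -/
lemma rowSpan_updateRow {p q : ℕ} {N : Matrix (Fin p) (Fin q) F[X]} {y : Fin q → F[X]}
    {D : F[X]} (hD : D ≠ 0) {c : Fin p → F[X]} (h : D • y = c ᵥ* N) {i : Fin p} (hi : c i ≠ 0) :
    rowSpan (N.updateRow i y) = rowSpan N := by
  have hD' : algebraMap F[X] (RatFunc F) D ≠ 0 := by simpa using hD
  have hi' : algebraMap F[X] (RatFunc F) (c i) ≠ 0 := by simpa using hi
  have h' := congrArg ratVec h
  rw [ratVec_smul, ratVec_vecMul] at h'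
  apply le_antisymm
  · refine Submodule.span_le.2 ?_
    rintro _ ⟨l, rfl⟩
    by_cases hl : l = i
    · subst hl
      rw [ratRow_update_self, SetLike.mem_coe, ← Submodule.smul_mem_iff _ hD', h']
      exact Submodule.sum_mem _ fun a _ =>
        Submodule.smul_mem _ _ (Submodule.subset_span ⟨a, rfl⟩)
    · rw [ratRow_update_ne N hl]
      exact Submodule.subset_span ⟨l, rfl⟩
  · have hne : ∀ l, l ≠ i → ratRow N l ∈ rowSpan (N.updateRow i y) := fun l hl =>
      Submodule.subset_span ⟨l, ratRow_update_ne N hl y⟩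
    refine Submodule.span_le.2 ?_
    rintro _ ⟨l, rfl⟩
    by_cases hl : l = i
    · subst hl
      rw [← Finset.add_sum_erase _ _ (Finset.mem_univ l), ← sub_eq_iff_eq_add] at h'
      rw [SetLike.mem_coe, ← Submodule.smul_mem_iff _ hi', ← h']
      refine Submodule.sub_mem _ (Submodule.smul_mem _ _
        (Submodule.subset_span ⟨l, ratRow_update_self N l y⟩)) ?_
      exact Submodule.sum_mem _ fun a ha => Submodule.smul_mem _ _ (hne a (Finset.ne_of_mem_erase ha))
    · exact hne l hl

/-- A row of a minimal basis cannot be exchanged for a vector of smaller degree. -/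
lemma IsMinimalBasisOf.exists_rowDeg_le {p q : ℕ}
    {V : Submodule (RatFunc F) (Fin q → RatFunc F)} {N : Matrix (Fin p) (Fin q) F[X]}
    (hN : IsMinimalBasisOf V N) {y : Fin q → F[X]} {D : F[X]} (hD : D ≠ 0) {c : Fin p → F[X]}
    (h : D • y = c ᵥ* N) {i : Fin p} (hi : c i ≠ 0) :
    ∃ j, (rowDeg N i : WithBot ℕ) ≤ (y j).degree := by
  by_contra! hlt
  have hspan := rowSpan_updateRow hD h hi
  have hind : LinearIndependent (RatFunc F) (ratRow (N.updateRow i y)) := by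
    rw [linearIndependent_iff_card_eq_finrank_span]
    refine (linearIndependent_iff_card_eq_finrank_span.1 hN.1).trans ?_
    simp only [Set.finrank]
    exact congrArg (fun W : Submodule (RatFunc F) (Fin q → RatFunc F) =>
      Module.finrank (RatFunc F) W) hspan.symm
  have hle := hN.2.2 _ hind (hspan.trans hN.2.1)
  rw [← Finset.add_sum_erase _ _ (Finset.mem_univ i),
    ← Finset.add_sum_erase _ (fun l => rowDeg (N.updateRow i y) l) (Finset.mem_univ i),
    Finset.sum_congr rfl fun l hl => rowDeg_update_ne N (Finset.ne_of_mem_erase hl) y,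
    Nat.add_le_add_iff_right] at hle
  rcases Nat.eq_zero_or_pos (rowDeg N i) with h0 | h0
  · have hy : y = 0 := by
      ext1 j
      simpa [h0, Nat.WithBot.lt_zero_iff] using hlt j
    rw [hy, smul_zero] at h
    exact hi (congrFun (eq_zero_of_vecMul_eq_zero hN.1 h.symm) i)
  · refine absurd hle (not_le.2 ((Finset.sup_lt_iff h0).2 fun j _ => ?_))
    rw [updateRow_self]
    by_cases hy : y j = 0
    · simpa [hy] using h0
    · exact (natDegree_lt_iff_degree_lt hy).2 (hlt j)

/-- The rows of a minimal basis generate all polynomial vectors of the subspace over `F[X]`. -/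
lemma IsMinimalBasisOf.exists_eq_vecMul {p q : ℕ}
    {V : Submodule (RatFunc F) (Fin q → RatFunc F)} {N : Matrix (Fin p) (Fin q) F[X]}
    (hN : IsMinimalBasisOf V N) {x : Fin q → F[X]} (hx : ratVec x ∈ V) :
    ∃ c : Fin p → F[X], x = c ᵥ* N := by
  rw [← hN.2.1] at hx
  obtain ⟨D, hD, c, hc⟩ := exists_smul_eq_vecMul hx
  set s : Fin p → F[X] := fun l => c l / D
  set r : Fin p → F[X] := fun l => c l % D
  have hcr : c = D • s + r := funext fun l => (EuclideanDomain.div_add_mod (c l) D).symm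
  have hy : D • (x - s ᵥ* N) = r ᵥ* N := by
    rw [smul_sub, hc, hcr, add_vecMul, smul_vecMul, add_sub_cancel_left]
  by_cases hr : r = 0
  · refine ⟨s, ?_⟩
    rw [hr, zero_vecMul, smul_eq_zero_iff_right hD] at hy
    exact sub_eq_zero.1 hy
  exfalso
  classical
  obtain ⟨l₀, hl₀⟩ := Function.ne_iff.1 hr
  obtain ⟨i, hi, hmax⟩ := Finset.exists_max_image (Finset.univ.filter fun l => r l ≠ 0) (rowDeg N)
    ⟨l₀, by simpa using hl₀⟩
  simp only [Finset.mem_filter, Finset.mem_univ, true_and] at hi hmax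
  obtain ⟨j, hj⟩ := hN.exists_rowDeg_le hD hy hi
  have hyj : (D * (x - s ᵥ* N) j).degree < D.degree + rowDeg N i := by
    rw [show D * (x - s ᵥ* N) j = ∑ l, r l * N l j from congrFun hy j]
    have hbot : (⊥ : WithBot ℕ) < D.degree + rowDeg N i := by
      rw [degree_eq_natDegree hD]; exact_mod_cast WithBot.bot_lt_coe _
    refine (degree_sum_le _ _).trans_lt ((Finset.sup_lt_iff hbot).2 fun l _ => ?_)
    by_cases hl : r l * N l j = 0
    · simpa only [hl, degree_zero] using hbot
    rw [degree_mul]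
    refine WithBot.add_lt_add_of_lt_of_le ?_ (EuclideanDomain.mod_lt (c l) hD) ?_
    · exact degree_ne_bot.2 (right_ne_zero_of_mul hl)
    · exact degree_le_natDegree.trans (Nat.cast_le.2
        ((natDegree_le_rowDeg N l j).trans (hmax l (left_ne_zero_of_mul hl))))
  rw [degree_mul] at hyj
  exact absurd hyj (not_lt.2 (by gcongr))

/-- The predictable degree property of minimal bases. -/
lemma IsMinimalBasisOf.natDegree_add_rowDeg_lt {p q : ℕ}
    {V : Submodule (RatFunc F) (Fin q → RatFunc F)} {N : Matrix (Fin p) (Fin q) F[X]}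
    (hN : IsMinimalBasisOf V N) {c : Fin p → F[X]} {k : ℕ}
    (hk : ∀ j, ((c ᵥ* N) j).degree < k) {i : Fin p} (hi : c i ≠ 0) :
    (c i).natDegree + rowDeg N i < k := by
  by_contra! hik
  classical
  obtain ⟨t, ht, hmax⟩ := Finset.exists_max_image (Finset.univ.filter fun l => c l ≠ 0)
    (fun l => (c l).natDegree + rowDeg N l) ⟨i, by simpa using hi⟩
  simp only [Finset.mem_filter, Finset.mem_univ, true_and] at ht hmax
  set T := (c t).natDegree + rowDeg N t with hT
  have hkT : k ≤ T := hik.trans (hmax i hi)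
  set top : Finset (Fin p) :=
    Finset.univ.filter fun l => c l ≠ 0 ∧ (c l).natDegree + rowDeg N l = T with htop
  obtain ⟨u, hu, humax⟩ := Finset.exists_max_image top (rowDeg N) ⟨t, by simp [htop, ht, hT]⟩
  simp only [htop, Finset.mem_filter, Finset.mem_univ, true_and] at hu humax
  set a : Fin p → F[X] := fun l =>
    if l ∈ top then monomial (rowDeg N u - rowDeg N l) (c l).leadingCoeff else 0 with ha
  have hcoeff : ∀ j, ((a ᵥ* N) j).coeff (rowDeg N u) = ((c ᵥ* N) j).coeff T := by
    intro j
    simp only [vecMul, dotProduct, finsetSum_coeff]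
    refine Finset.sum_congr rfl fun l _ => ?_
    by_cases hl : l ∈ top
    · have hl' := hl
      simp only [htop, Finset.mem_filter, Finset.mem_univ, true_and] at hl'
      have hul := humax l hl'
      simp only [ha, if_pos hl]
      rw [← hl'.2, coeff_mul_add_eq_of_natDegree_le le_rfl (natDegree_le_rowDeg N l j),
        coeff_natDegree, ← coeff_monomial_mul, Nat.add_sub_cancel' hul]
    · simp only [ha, if_neg hl, zero_mul, coeff_zero]
      by_cases hcl : c l = 0
      · simp [hcl]
      have hlt : (c l).natDegree + rowDeg N l < T :=
        lt_of_le_of_ne (hmax l hcl) fun h => hl (by simp [htop, hcl, h])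
      refine (coeff_eq_zero_of_natDegree_lt (natDegree_mul_le.trans_lt ?_)).symm
      have := natDegree_le_rowDeg N l j
      omega
  have hau : a u ≠ 0 := by
    have : u ∈ top := by simp [htop, hu.1, hu.2]
    simpa [ha, this] using hu.1
  obtain ⟨j, hj⟩ := hN.exists_rowDeg_le (one_ne_zero (α := F[X])) (one_smul F[X] (a ᵥ* N)) hau
  refine absurd hj (not_le.2 (lt_of_le_of_ne ?_ fun h => ?_))
  · rw [show (a ᵥ* N) j = ∑ l, a l * N l j from rfl]
    refine degree_le_of_natDegree_le (natDegree_sum_le_of_forall_le _ _ fun l _ => ?_)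
    by_cases hl : l ∈ top
    · have hl' := hl
      simp only [htop, Finset.mem_filter, Finset.mem_univ, true_and] at hl'
      have hul := humax l hl'
      refine natDegree_mul_le.trans ?_
      simp only [ha, if_pos hl]
      have h1 := natDegree_monomial_le (m := rowDeg N u - rowDeg N l) (c l).leadingCoeff
      have h2 := natDegree_le_rowDeg N l j
      omega
    · simp [ha, hl]
  · refine coeff_ne_zero_of_eq_degree h ?_
    rw [hcoeff]
    exact coeff_eq_zero_of_degree_lt ((hk j).trans_le (by exact_mod_cast hkT))

/-- The polynomial vector of degree less than `k` with given coefficients. -/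
def polyVec {k q : ℕ} (v : Fin k × Fin q → F) : Fin q → F[X] :=
  fun j => ∑ t : Fin k, monomial t (v (t, j))

/-- The coefficients of order less than `k` of a polynomial vector. -/
def coeffVec (k : ℕ) {q : ℕ} (x : Fin q → F[X]) : Fin k × Fin q → F :=
  fun c => (x c.2).coeff c.1

lemma degree_polyVec_lt {k q : ℕ} (v : Fin k × Fin q → F) (j : Fin q) :
    (polyVec v j).degree < k := by
  refine (degree_sum_le _ _).trans_lt ((Finset.sup_lt_iff (WithBot.bot_lt_coe k)).2 fun t _ => ?_)
  exact (degree_monomial_le _ _).trans_lt (Nat.cast_lt.2 t.2)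

lemma coeffVec_polyVec {k q : ℕ} (v : Fin k × Fin q → F) : coeffVec k (polyVec v) = v := by
  ext ⟨t, j⟩
  simp [coeffVec, polyVec, coeff_monomial, Fin.val_inj]

lemma polyVec_coeffVec {k q : ℕ} {x : Fin q → F[X]} (hx : ∀ j, (x j).degree < k) :
    polyVec (coeffVec k x) = x := by
  ext j s
  by_cases hs : s < k
  · exact congrFun (coeffVec_polyVec (coeffVec k x)) (⟨s, hs⟩, j)
  · have hks : (k : WithBot ℕ) ≤ s := by exact_mod_cast not_lt.1 hs
    rw [coeff_eq_zero_of_degree_lt ((degree_polyVec_lt _ j).trans_le hks),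
      coeff_eq_zero_of_degree_lt ((hx j).trans_le hks)]

lemma sylv_mulVec {p q d k : ℕ} {M : Matrix (Fin p) (Fin q) F[X]}
    (hM : ∀ i j, (M i j).natDegree ≤ d) (v : Fin k × Fin q → F) (s : Fin (k + d)) (i : Fin p) :
    (sylv d k M *ᵥ v) (s, i) = ((M *ᵥ polyVec v) i).coeff s := by
  simp only [mulVec, dotProduct, polyVec, Finset.mul_sum, finsetSum_coeff]
  rw [Fintype.sum_prod_type_right]
  refine Finset.sum_congr rfl fun j _ => Finset.sum_congr rfl fun t _ => ?_
  rw [← C_mul_X_pow_eq_monomial, ← mul_assoc, coeff_mul_X_pow', coeff_mul_C]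
  simp only [sylv]
  by_cases h1 : (t : ℕ) ≤ s
  · by_cases h2 : (s : ℕ) ≤ t + d
    · simp [h1, h2]
    · rw [coeff_eq_zero_of_natDegree_lt ((hM i j).trans_lt (by omega))]
      simp [h2]
  · simp [h1]

lemma sylv_mulVec_eq_zero_iff {p q d k : ℕ} {M : Matrix (Fin p) (Fin q) F[X]}
    (hM : ∀ i j, (M i j).natDegree ≤ d) (v : Fin k × Fin q → F) :
    sylv d k M *ᵥ v = 0 ↔ M *ᵥ polyVec v = 0 := by
  constructor
  · intro h
    ext i s
    by_cases hs : s < k + d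
    · simpa [h] using (sylv_mulVec hM v ⟨s, hs⟩ i).symm
    · simp only [mulVec, dotProduct, finsetSum_coeff]
      refine Finset.sum_eq_zero fun j _ => ?_
      by_cases hv : polyVec v j = 0
      · simp [hv]
      have := (natDegree_lt_iff_degree_lt hv).2 (degree_polyVec_lt v j)
      have := hM i j
      exact coeff_eq_zero_of_natDegree_lt (natDegree_mul_le.trans_lt (by omega))
  · intro h
    ext ⟨s, i⟩
    simp [sylv_mulVec hM, h]

/-- The coefficient vectors of polynomial combinations of the rows of `N` of degree less
than `k`. -/
def combCoeff {p q : ℕ} (N : Matrix (Fin p) (Fin q) F[X]) (k : ℕ) :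
    (∀ i, degreeLT F (k - rowDeg N i)) →ₗ[F] (Fin k × Fin q → F) where
  toFun c := coeffVec k ((fun i => (c i : F[X])) ᵥ* N)
  map_add' c c' := by
    ext ⟨t, j⟩
    simp [coeffVec, vecMul, dotProduct, add_mul, Finset.sum_add_distrib]
  map_smul' a c := by
    ext ⟨t, j⟩
    simp [coeffVec, vecMul, dotProduct, Finset.mul_sum]

lemma degree_vecMul_lt {p q k : ℕ} (N : Matrix (Fin p) (Fin q) F[X])
    (c : ∀ i, degreeLT F (k - rowDeg N i)) (j : Fin q) :
    degree (((fun i => (c i : F[X])) ᵥ* N) j) < k := by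
  simp only [vecMul, dotProduct]
  refine (degree_sum_le _ _).trans_lt ((Finset.sup_lt_iff (WithBot.bot_lt_coe k)).2 fun l _ => ?_)
  have hc := mem_degreeLT.1 (c l).2
  by_cases hl : (c l : F[X]) * N l j = 0
  · rw [hl]; exact WithBot.bot_lt_coe k
  have h1 := (natDegree_lt_iff_degree_lt (left_ne_zero_of_mul hl)).2 hc
  have h2 := natDegree_le_rowDeg N l j
  exact (natDegree_lt_iff_degree_lt hl).1 (natDegree_mul_le.trans_lt (by omega))

lemma combCoeff_injective {p q : ℕ} {N : Matrix (Fin p) (Fin q) F[X]}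
    (hN : LinearIndependent (RatFunc F) (ratRow N)) (k : ℕ) :
    Function.Injective (combCoeff N k) := by
  refine (injective_iff_map_eq_zero _).2 fun c hc => ?_
  have h : coeffVec k ((fun i => (c i : F[X])) ᵥ* N) = 0 := hc
  have h' := polyVec_coeffVec (degree_vecMul_lt N c)
  rw [h] at h'
  have h0 := eq_zero_of_vecMul_eq_zero hN
    (h'.symm.trans (by ext1 j; simp [polyVec]))
  ext1 i
  exact Subtype.ext (congrFun h0 i)

lemma range_combCoeff {p q n d : ℕ} {M : Matrix (Fin p) (Fin q) F[X]}
    (hM : ∀ i j, (M i j).natDegree ≤ d) {N : Matrix (Fin n) (Fin q) F[X]}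
    (hN : IsMinimalBasisOf (rightNullSpace M) N) (k : ℕ) :
    LinearMap.range (combCoeff N k) = LinearMap.ker (sylv d k M).mulVecLin := by
  ext v
  rw [LinearMap.mem_ker, mulVecLin_apply, sylv_mulVec_eq_zero_iff hM, ← ratVec_mem_rightNullSpace]
  constructor
  · rintro ⟨c, rfl⟩
    change ratVec (polyVec (coeffVec k ((fun i => (c i : F[X])) ᵥ* N))) ∈ _
    rw [polyVec_coeffVec (degree_vecMul_lt N c), ratVec_vecMul, ← hN.2.1]
    exact Submodule.sum_mem _ fun l _ => Submodule.smul_mem _ _ (Submodule.subset_span ⟨l, rfl⟩)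
  · intro h
    obtain ⟨c, hc⟩ := hN.exists_eq_vecMul h
    refine ⟨fun i => ⟨c i, mem_degreeLT.2 ?_⟩, ?_⟩
    · by_cases hi : c i = 0
      · rw [hi]; exact WithBot.bot_lt_coe _
      · have := hN.natDegree_add_rowDeg_lt (fun j => hc ▸ degree_polyVec_lt v j) hi
        exact (natDegree_lt_iff_degree_lt hi).1 (by omega)
    · change coeffVec k (c ᵥ* N) = v
      rw [← hc, coeffVec_polyVec]

/-- The right nullities of the Sylvester matrices in terms of the right minimal indices. -/
lemma rank_sylv_add_sum {p q n d : ℕ} {M : Matrix (Fin p) (Fin q) F[X]}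
    (hM : ∀ i j, (M i j).natDegree ≤ d) {N : Matrix (Fin n) (Fin q) F[X]}
    (hN : IsMinimalBasisOf (rightNullSpace M) N) (k : ℕ) :
    (sylv d k M).rank + ∑ i, (k - rowDeg N i) = k * q := by
  have h := (sylv d k M).mulVecLin.finrank_range_add_finrank_ker
  rw [← range_combCoeff hM hN, LinearMap.finrank_range_of_inj (combCoeff_injective hN.1 k),
    Module.finrank_pi_fintype] at h
  simpa [Matrix.rank, (degreeLTEquiv F _).finrank_eq] using h

lemma card_filter_rowDeg_eq {n q : ℕ} (N : Matrix (Fin n) (Fin q) F[X]) (k : ℕ) :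
    (Finset.univ.filter fun i => rowDeg N i = k).card + 2 * ∑ i, (k - rowDeg N i) =
      ∑ i, (k + 1 - rowDeg N i) + ∑ i, (k - 1 - rowDeg N i) := by
  rw [Finset.card_filter, Finset.mul_sum, ← Finset.sum_add_distrib, ← Finset.sum_add_distrib]
  refine Finset.sum_congr rfl fun i _ => ?_
  split_ifs <;> omega

/-- Recursive relations between the numbers `α_k` of right minimal indices of `M(λ)`
equal to `k` and the ranks `r_k` and right nullities `n_k` of its Sylvester matrices:
`α_0 = m + n - r_1 = n_1` and
`α_k = (n_{k+1} - n_k) - (n_k - n_{k-1}) = (r_k - r_{k-1}) - (r_{k+1} - r_k)`. -/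
theorem rightMinimalIndices_sylvester_recurrence {F : Type*} [Field F] {m n d : ℕ}
    (hm : 0 < m) (hn : 0 < n) (hd : 0 < d)
    (M : Matrix (Fin m) (Fin (m + n)) F[X]) (hdeg : ∀ i j, (M i j).natDegree ≤ d)
    (hrk : (ratMat M).rank = m)
    (N : Matrix (Fin n) (Fin (m + n)) F[X])
    (hN : IsMinimalBasisOf (rightNullSpace M) N) :
    let r : ℕ → ℕ := fun j => (sylv d j M).rank
    let nl : ℕ → ℕ := fun j => j * (m + n) - (sylv d j M).rank
    let α : ℕ → ℕ := fun k => (Finset.univ.filter fun i => rowDeg N i = k).card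
    α 0 = m + n - r 1 ∧ α 0 = nl 1 ∧
      ∀ k : ℕ, 1 ≤ k →
        ((α k : ℤ) = ((nl (k + 1) : ℤ) - (nl k : ℤ)) - ((nl k : ℤ) - (nl (k - 1) : ℤ)) ∧
         (α k : ℤ) = ((r k : ℤ) - (r (k - 1) : ℤ)) - ((r (k + 1) : ℤ) - (r k : ℤ))) := by
  intro r nl α
  have hsum : ∀ j, r j + ∑ i, (j - rowDeg N i) = j * (m + n) := rank_sylv_add_sum hdeg hN
  have hnl : ∀ j, nl j = ∑ i, (j - rowDeg N i) := fun j =>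
    Nat.sub_eq_of_eq_add' (hsum j).symm
  have hα : ∀ k, α k + 2 * nl k = nl (k + 1) + nl (k - 1) := fun k => by
    simp only [hnl]
    exact card_filter_rowDeg_eq N k
  have h0 : α 0 = nl 1 := by simpa [hnl] using hα 0
  refine ⟨h0.trans (by simp [nl, r]), h0, fun k hk => ?_⟩
  specialize hα k
  simp only [← hnl] at hsum
  obtain ⟨k, rfl⟩ := Nat.exists_eq_add_of_le' hk
  have h₁ := hsum k
  have h₂ := hsum (k + 1)
  have h₃ := hsum (k + 1 + 1)
  simp only [Nat.add_sub_cancel] at hα ⊢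
  zify at hα h₁ h₂ h₃
  exact ⟨by linarith, by linarith⟩

end
end

section
/- Let F = ℝ or F = ℂ and let Syl[λ]^{m×(m+n)}_d be the set of polynomial matrices of size m×(m+n), degree at most d, with full-Sylvester-rank. Then the complement of Syl[λ]^{m×(m+n)}_d in F[λ]^{m×(m+n)}_d is a proper algebraic set: identifying F[λ]^{m×(m+n)}_d with ℝ^{(d+1)m(m+n)} (for F = ℝ) or ℝ^{2(d+1)m(m+n)} (for F = ℂ) via the entries (respectively the real and imaginary parts of the entries) of the coefficients M_0, …, M_d, the complement is contained in the common zero set of finitely many real multivariable polynomials that do not all vanish identically, and hence it is not the whole space. Consequently, Syl[λ]^{m×(m+n)}_d is a generic subset of F[λ]^{m×(m+n)}_d. -/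
open Polynomial Matrix

noncomputable section

variable {F : Type*} [Field F]

/-- The Sylvester matrix built from a sequence of coefficient matrices. -/
def coeffSylv {R : Type*} [Zero R] {p q : ℕ} (e k : ℕ) (v : ℕ → Fin p → Fin q → R) :
    Matrix (Fin (k + e) × Fin p) (Fin k × Fin q) R :=
  fun r c =>
    if (c.1 : ℕ) ≤ (r.1 : ℕ) ∧ (r.1 : ℕ) ≤ (c.1 : ℕ) + e then
      v ((r.1 : ℕ) - (c.1 : ℕ)) r.2 c.2
    else 0

lemma sylv_eq_coeffSylv {p q : ℕ} (e k : ℕ) (M : Matrix (Fin p) (Fin q) F[X]) :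
    sylv e k M = coeffSylv e k fun l i j => (M i j).coeff l := rfl

/-- The columns of `A` are linearly independent, stated through the kernel. -/
def ColFull {I J : Type*} [Fintype J] (A : Matrix I J F) : Prop :=
  ∀ x : J → F, A *ᵥ x = 0 → x = 0

lemma ColFull.rank_eq {I J : Type*} [Fintype I] [Fintype J]
    {A : Matrix I J F} (h : ColFull A) : A.rank = Fintype.card J := by
  have hinj : Function.Injective A.mulVecLin :=
    (injective_iff_map_eq_zero _).2 fun x hx => h x hx
  rw [Matrix.rank, LinearMap.finrank_range_of_inj hinj, Module.finrank_fintype_fun_eq_card]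

lemma ColFull.exists_left_inverse {I J : Type*} [Fintype I] [Fintype J]
    [DecidableEq J] {A : Matrix I J F} (h : ColFull A) :
    ∃ B : Matrix J I F, B * A = 1 := by
  classical
  have hker : LinearMap.ker (Matrix.toLin' A) = ⊥ :=
    LinearMap.ker_eq_bot'.2 fun x hx => h x (by simpa using hx)
  obtain ⟨g, hg⟩ := LinearMap.exists_leftInverse_of_injective (Matrix.toLin' A) hker
  refine ⟨LinearMap.toMatrix' g, ?_⟩
  have := congrArg LinearMap.toMatrix' hg
  simpa [LinearMap.toMatrix'_comp] using this

/-- Having linearly independent columns is an open condition: it is implied by the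
non-vanishing of a polynomial. -/
lemma exists_polynomial_colFull {σ I J : Type*} [Fintype I] [Fintype J]
    (G : Matrix I J (MvPolynomial σ F)) (v₀ : σ → F)
    (h : ColFull (G.map (MvPolynomial.eval v₀))) :
    ∃ P : MvPolynomial σ F, P ≠ 0 ∧
      ∀ v, MvPolynomial.eval v P ≠ 0 → ColFull (G.map (MvPolynomial.eval v)) := by
  classical
  obtain ⟨B, hB⟩ := h.exists_left_inverse
  let B' : Matrix J I (MvPolynomial σ F) := B.map MvPolynomial.C
  have key : ∀ v, MvPolynomial.eval v (B' * G).det =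
      (B * G.map (MvPolynomial.eval v)).det := by
    intro v
    rw [RingHom.map_det, RingHom.mapMatrix_apply, Matrix.map_mul, Matrix.map_map]
    congr 2
    ext i j
    simp
  refine ⟨(B' * G).det, fun h0 => ?_, fun v hv x hx => ?_⟩
  · have := key v₀
    rw [h0, hB, Matrix.det_one, map_zero] at this
    exact zero_ne_one this
  · rw [key] at hv
    refine Matrix.eq_zero_of_mulVec_eq_zero hv ?_
    rw [← Matrix.mulVec_mulVec, hx, Matrix.mulVec_zero]

/-- A matrix that is triangular with respect to a ranking of its columns has linearly
independent columns. -/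
lemma colFull_of_triangular {I J α : Type*} [Fintype J] [LinearOrder α]
    {A : Matrix I J F} (ρ : J → α)
    (h : ∀ j, ∃ i, A i j ≠ 0 ∧ ∀ j', A i j' ≠ 0 → j' = j ∨ ρ j < ρ j') : ColFull A := by
  classical
  intro x hx
  by_contra hne
  have hs : (Finset.univ.filter fun j => x j ≠ 0).Nonempty := by
    obtain ⟨j, hj⟩ := Function.ne_iff.1 hne
    exact ⟨j, by simpa using hj⟩
  obtain ⟨j, hj, hmax⟩ := Finset.exists_max_image _ ρ hs
  obtain ⟨i, hij, hi⟩ := h j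
  have hsum : ∑ j', A i j' * x j' = 0 := congrFun hx i
  rw [Finset.sum_eq_single j] at hsum
  · exact mul_ne_zero hij (Finset.mem_filter.1 hj).2 hsum
  · intro j' _ hj'
    by_contra hne'
    rcases hi j' (left_ne_zero_of_mul hne') with h1 | h1
    · exact hj' h1
    · exact absurd (hmax j' (by simpa using right_ne_zero_of_mul hne')) (not_le.2 h1)
  · simp

lemma coeffSylv_map {R S : Type*} [Semiring R] [Semiring S] (f : R →+* S) {p q : ℕ} (e k : ℕ)
    (v : ℕ → Fin p → Fin q → R) :
    (coeffSylv e k v).map f = coeffSylv e k fun l i j => f (v l i j) := by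
  ext r c
  simp only [coeffSylv, Matrix.map_apply]
  split_ifs <;> simp

lemma coeffSylv_mulVec {p q : ℕ} (e k : ℕ) (v : ℕ → Fin p → Fin q → F)
    (x : ℕ → Fin q → F) (r : Fin (k + e) × Fin p) :
    (coeffSylv e k v *ᵥ fun c => x c.1 c.2) r =
      ∑ c ∈ Finset.range k, ∑ j,
        (if c ≤ (r.1 : ℕ) ∧ (r.1 : ℕ) ≤ c + e then v (r.1 - c) r.2 j else 0) * x c j := by
  rw [Finset.sum_range]
  exact Fintype.sum_prod_type _

lemma coeffSylv_transpose_mulVec {p q : ℕ} (e k : ℕ) (v : ℕ → Fin p → Fin q → F)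
    (y : ℕ → Fin p → F) (c : Fin k × Fin q) :
    ((coeffSylv e k v)ᵀ *ᵥ fun r => y r.1 r.2) c =
      ∑ l ∈ Finset.range (e + 1), ∑ i, v l i c.2 * y (c.1 + l) i := by
  have hc := c.1.2
  have h1 : ((coeffSylv e k v)ᵀ *ᵥ fun r => y r.1 r.2) c =
      ∑ r ∈ Finset.range (k + e), ∑ i,
        (if (c.1 : ℕ) ≤ r ∧ r ≤ (c.1 : ℕ) + e then v (r - c.1) i c.2 else 0) * y r i := by
    rw [Finset.sum_range]
    exact Fintype.sum_prod_type _
  rw [h1]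
  symm
  refine Finset.sum_of_injOn (fun l => (c.1 : ℕ) + l) (fun a _ b _ h => by simpa using h)
    (fun l hl => ?_) (fun r hr hr' => ?_) (fun l hl => ?_)
  · simp only [Finset.coe_range, Set.mem_Iio] at hl ⊢
    lia
  · refine Finset.sum_eq_zero fun i _ => ?_
    rw [if_neg, zero_mul]
    rintro ⟨h2, h3⟩
    exact hr' ⟨r - c.1, by simp; lia, by simp; lia⟩
  · simp only [Finset.mem_range] at hl
    refine Finset.sum_congr rfl fun i _ => ?_
    rw [if_pos ⟨by lia, by lia⟩, Nat.add_sub_cancel_left]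

lemma colFull_coeffSylv_of_le {p q e k k' : ℕ} {v : ℕ → Fin p → Fin q → F} (hk : k' ≤ k)
    (h : ColFull (coeffSylv e k v)) : ColFull (coeffSylv e k' v) := by
  intro x hx
  let z : ℕ → Fin q → F := fun c j => if hc : c < k' then x (⟨c, hc⟩, j) else 0
  have hz : x = fun c => z c.1 c.2 := by
    ext c
    simp [z]
  have hsub : ∀ r i, ∑ c ∈ Finset.range k, ∑ j,
        (if c ≤ r ∧ r ≤ c + e then v (r - c) i j else 0) * z c j =
      ∑ c ∈ Finset.range k', ∑ j,
        (if c ≤ r ∧ r ≤ c + e then v (r - c) i j else 0) * z c j := by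
    intro r i
    symm
    refine Finset.sum_subset (Finset.range_mono hk) fun c _ hc => ?_
    have : ¬ c < k' := by simpa using hc
    simp [z, this]
  have h0 : (coeffSylv e k v *ᵥ fun c => z c.1 c.2) = 0 := by
    ext r
    rw [coeffSylv_mulVec, hsub]
    by_cases hr : (r.1 : ℕ) < k' + e
    · have := congrFun hx (⟨r.1, hr⟩, r.2)
      rwa [hz, coeffSylv_mulVec] at this
    · refine Finset.sum_eq_zero fun c hc => Finset.sum_eq_zero fun j _ => ?_
      rw [Finset.mem_range] at hc
      rw [if_neg (by lia), zero_mul]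
  have h1 := h _ h0
  ext c
  rw [hz]
  exact congrFun h1 (⟨c.1, by lia⟩, c.2)

lemma colFull_coeffSylv_transpose_succ {p q e k : ℕ} {v : ℕ → Fin p → Fin q → F}
    (hke : 0 < k + e) (h : ColFull (coeffSylv e k v)ᵀ) : ColFull (coeffSylv e (k + 1) v)ᵀ := by
  intro y hy
  let Y : ℕ → Fin p → F := fun r i => if hr : r < k + 1 + e then y (⟨r, hr⟩, i) else 0
  have hY : y = fun r => Y r.1 r.2 := by
    ext r
    simp [Y]
  rw [hY] at hy
  have hrec : ∀ c < k + 1, ∀ j, ∑ l ∈ Finset.range (e + 1), ∑ i, v l i j * Y (c + l) i = 0 := by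
    intro c hc j
    rw [← coeffSylv_transpose_mulVec e (k + 1) v Y (⟨c, hc⟩, j), hy]
    rfl
  have h0 := h (fun r => Y r.1 r.2) <| by
    ext c
    rw [coeffSylv_transpose_mulVec]
    exact hrec _ (by lia) _
  have h1 := h (fun r => Y (r.1 + 1) r.2) <| by
    ext c
    rw [coeffSylv_transpose_mulVec e k v (fun r => Y (r + 1))]
    simpa only [add_right_comm, Pi.zero_apply] using hrec (c.1 + 1) (by lia) c.2
  ext ⟨⟨r, hr⟩, i⟩
  rw [hY]
  rcases r with _ | r
  · exact congrFun h0 (⟨0, hke⟩, i)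
  · exact congrFun h1 (⟨r, by lia⟩, i)

lemma colFull_coeffSylv_transpose_of_le {p q e k k' : ℕ} {v : ℕ → Fin p → Fin q → F}
    (hke : 0 < k + e) (hk : k ≤ k') (h : ColFull (coeffSylv e k v)ᵀ) :
    ColFull (coeffSylv e k' v)ᵀ := by
  induction k', hk using Nat.le_induction with
  | base => exact h
  | succ l hl ih => exact colFull_coeffSylv_transpose_succ (by lia) ih

/-! ### A zigzag matrix with Sylvester matrix of full rank -/

/-- The support of the zigzag coefficients for the parameter `k`: the `j`-th column starts
at row `j * k / (k + d)`. -/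
def zigzag (k d l i j : ℕ) : Prop :=
  (i = j * k / (k + d) ∧ l = min (j * k % (k + d)) d) ∨
    (i = j * k / (k + d) + 1 ∧ d < j * k % (k + d) ∧ l = 0)

/-- The pivot relation: the entry at row `(r, i)` and column `(t, j)` is the pivot. -/
def ZigzagPivot (k d r i t j : ℕ) : Prop :=
  (j * k % (k + d) ≤ t + d ∧ i = j * k / (k + d) ∧ r = t + min (j * k % (k + d)) d) ∨
    (t + d < j * k % (k + d) ∧ i = j * k / (k + d) + 1 ∧ r = t)

/-- The ranking of the columns for which the zigzag Sylvester matrix is triangular. -/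
def zigzagRank (k d N t j : ℕ) : ℕ :=
  if j * k % (k + d) ≤ d then 0
  else if j * k % (k + d) ≤ t + d then N + 1 - j
  else j + 1

lemma ZigzagPivot.pos {k d r i t j : ℕ} (ht : t < k) (h : ZigzagPivot k d r i t j) :
    j * k ≤ i * (k + d) + r ∧ i * (k + d) + r < j * k + k := by
  have h1 := Nat.div_add_mod' (j * k) (k + d)
  have h2 := Nat.mod_lt (j * k) (show 0 < k + d by lia)
  rcases h with ⟨h, rfl, rfl⟩ | ⟨h, rfl, rfl⟩
  · lia
  · rw [Nat.add_mul]
    lia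

lemma eq_of_mul_le_of_lt {k a b : ℕ} {L : ℕ} (h1 : a * k ≤ L) (h2 : L < a * k + k)
    (h3 : b * k ≤ L) (h4 : L < b * k + k) : a = b := by
  rw [← Nat.succ_mul] at h2 h4
  exact (Nat.div_eq_of_lt_le h1 h2).symm.trans (Nat.div_eq_of_lt_le h3 h4)

lemma ZigzagPivot.eq_or_rank_lt {k d N r i t j t' j' : ℕ} (ht : t < k) (ht' : t' < k)
    (hj : j' < N) (h : ZigzagPivot k d r i t j) (hle : t' ≤ r)
    (h' : zigzag k d (r - t') i j') :
    (t' = t ∧ j' = j) ∨ zigzagRank k d N t j < zigzagRank k d N t' j' := by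
  obtain ⟨p1, p2⟩ := h.pos ht
  have e := Nat.div_add_mod' (j * k) (k + d)
  have e' := Nat.div_add_mod' (j' * k) (k + d)
  have m := Nat.mod_lt (j * k) (show 0 < k + d by lia)
  have m' := Nat.mod_lt (j' * k) (show 0 < k + d by lia)
  have of_pivot (hp : ZigzagPivot k d r i t' j') : t' = t ∧ j' = j := by
    obtain ⟨p1', p2'⟩ := hp.pos ht'
    obtain rfl := eq_of_mul_le_of_lt p1 p2 p1' p2'
    refine ⟨?_, rfl⟩
    rcases h with ⟨_, _, _⟩ | ⟨_, _, _⟩ <;> rcases hp with ⟨_, _, _⟩ | ⟨_, _, _⟩ <;> lia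
  rcases h' with ⟨hi, hr⟩ | ⟨hi, hd, hr⟩
  · by_cases hx : j' * k % (k + d) ≤ t' + d
    · exact Or.inl (of_pivot (Or.inl ⟨hx, hi, by lia⟩))
    · right
      rw [← hi] at e'
      obtain _ | j₀ := j'
      · simp at hx
      have hj₀ : (j₀ + 1) * k = j₀ * k + k := Nat.succ_mul _ _
      obtain rfl : j = j₀ := eq_of_mul_le_of_lt p1 p2 (by lia) (by lia)
      rcases h with ⟨h1, h2, h3⟩ | ⟨h1, h2, h3⟩
      · rw [← h2] at e
        unfold zigzagRank
        split_ifs <;> lia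
      · unfold zigzagRank
        split_ifs <;> lia
  · by_cases hx : j' * k % (k + d) ≤ t' + d
    · right
      have hs : (j' * k / (k + d) + 1) * (k + d) = j' * k / (k + d) * (k + d) + (k + d) :=
        Nat.succ_mul _ _
      have hj₀ : (j' + 1) * k = j' * k + k := Nat.succ_mul _ _
      rw [hi] at p1 p2
      obtain rfl : j = j' + 1 := eq_of_mul_le_of_lt p1 p2 (by lia) (by lia)
      rcases h with ⟨h1, h2, h3⟩ | ⟨h1, h2, h3⟩
      · unfold zigzagRank
        split_ifs <;> lia
      · rw [show (j' + 1) * k / (k + d) = j' * k / (k + d) by lia] at e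
        lia
    · exact Or.inl (of_pivot (Or.inr ⟨by lia, hi, by lia⟩))

lemma exists_zigzagPivot_row (k d t j : ℕ) (ht : t < k) :
    ∃ r i, r < k + d ∧ ZigzagPivot k d r i t j := by
  have h2 := Nat.mod_lt (j * k) (show 0 < k + d by lia)
  by_cases h : j * k % (k + d) ≤ t + d
  · exact ⟨_, _, by lia, Or.inl ⟨h, rfl, rfl⟩⟩
  · exact ⟨_, _, by lia, Or.inr ⟨by lia, rfl, rfl⟩⟩

lemma exists_zigzagPivot_col {k d r : ℕ} (i : ℕ) (hk : 0 < k) (hr : r < k + d) :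
    ∃ t j, t < k ∧ ZigzagPivot k d r i t j := by
  obtain ⟨j, u, hu, hL⟩ : ∃ j u, u < k ∧ j * k + u = i * (k + d) + r :=
    ⟨_, _, Nat.mod_lt _ hk, Nat.div_add_mod' _ k⟩
  have e := Nat.div_add_mod' (j * k) (k + d)
  have m := Nat.mod_lt (j * k) (show 0 < k + d by lia)
  have h1 : j * k / (k + d) < i + 1 := by
    refine lt_of_mul_lt_mul_right (a := k + d) ?_ (Nat.zero_le _)
    rw [Nat.succ_mul]
    lia
  have h2 : i < j * k / (k + d) + 2 := by
    refine lt_of_mul_lt_mul_right (a := k + d) ?_ (Nat.zero_le _)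
    rw [Nat.add_mul]
    lia
  obtain hi | hi : i = j * k / (k + d) ∨ i = j * k / (k + d) + 1 := by lia
  · rw [← hi] at e
    by_cases hx : j * k % (k + d) ≤ d
    · exact ⟨u, j, hu, Or.inl ⟨by lia, hi, by lia⟩⟩
    · exact ⟨r - d, j, by lia, Or.inl ⟨by lia, hi, by lia⟩⟩
  · rw [hi, Nat.succ_mul] at hL
    exact ⟨r, j, by lia, Or.inr ⟨by lia, hi, rfl⟩⟩

lemma ZigzagPivot.zigzag {k d r i t j : ℕ} (h : ZigzagPivot k d r i t j) :
    t ≤ r ∧ r ≤ t + d ∧ zigzag k d (r - t) i j := by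
  rcases h with ⟨h, rfl, rfl⟩ | ⟨h, rfl, rfl⟩
  · exact ⟨by lia, by lia, Or.inl ⟨rfl, by lia⟩⟩
  · exact ⟨by lia, by lia, Or.inr ⟨rfl, by lia, by lia⟩⟩

open Classical in
/-- The zigzag coefficients as elements of a field. -/
def zigzagCoeff (F : Type*) [Field F] {p q : ℕ} (k d : ℕ) (l : ℕ) (i : Fin p) (j : Fin q) : F :=
  if zigzag k d l i j then 1 else 0

lemma coeffSylv_zigzagCoeff_ne_zero_iff {p q k d : ℕ} (r : Fin (k + d) × Fin p)
    (c : Fin k × Fin q) :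
    coeffSylv d k (zigzagCoeff F k d) r c ≠ 0 ↔
      ((c.1 : ℕ) ≤ r.1 ∧ (r.1 : ℕ) ≤ c.1 + d) ∧ zigzag k d (r.1 - c.1) r.2 c.2 := by
  simp [coeffSylv, zigzagCoeff, and_assoc]

lemma colFull_zigzag {p q k d : ℕ} (h : k * q ≤ (k + d) * p) :
    ColFull (coeffSylv d k (zigzagCoeff F (p := p) (q := q) k d)) := by
  refine colFull_of_triangular (fun c => zigzagRank k d q c.1 c.2) ?_
  rintro ⟨⟨t, ht⟩, ⟨j, hj⟩⟩
  obtain ⟨r, i, hr, hp⟩ := exists_zigzagPivot_row k d t j ht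
  have hi : i < p := by
    have h1 := (hp.pos ht).2
    have h2 : (j + 1) * k ≤ q * k := Nat.mul_le_mul_right _ hj
    by_contra! h3
    have h4 := Nat.mul_le_mul_right (k + d) h3
    nlinarith
  refine ⟨(⟨r, hr⟩, ⟨i, hi⟩), ?_, ?_⟩
  · obtain ⟨h1, h2, h3⟩ := hp.zigzag
    exact (coeffSylv_zigzagCoeff_ne_zero_iff _ _).2 ⟨⟨h1, h2⟩, h3⟩
  · rintro ⟨⟨t', ht'⟩, ⟨j', hj'⟩⟩ hne
    obtain ⟨⟨h1, h2⟩, h3⟩ := (coeffSylv_zigzagCoeff_ne_zero_iff _ _).1 hne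
    rcases hp.eq_or_rank_lt ht ht' hj' h1 h3 with ⟨rfl, rfl⟩ | hlt
    · exact Or.inl rfl
    · exact Or.inr hlt

lemma colFull_zigzag_transpose {p q k d : ℕ} (hk : 0 < k) (h : (k + d) * p ≤ k * q) :
    ColFull (coeffSylv d k (zigzagCoeff F (p := p) (q := q) k d))ᵀ := by
  choose! T J hT hTJ using fun r i (hr : r < k + d) => exists_zigzagPivot_col i hk hr
  refine colFull_of_triangular
    (fun r => OrderDual.toDual (zigzagRank k d q (T r.1 r.2) (J r.1 r.2))) ?_
  rintro ⟨⟨r, hr⟩, ⟨i, hi⟩⟩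
  have hp := hTJ r i hr
  have hj : J r i < q := by
    have h1 := (hp.pos (hT r i hr)).1
    have h2 : (i + 1) * (k + d) ≤ p * (k + d) := Nat.mul_le_mul_right _ hi
    by_contra! h3
    have h4 := Nat.mul_le_mul_right k h3
    nlinarith
  refine ⟨(⟨T r i, hT r i hr⟩, ⟨J r i, hj⟩), ?_, ?_⟩
  · obtain ⟨h1, h2, h3⟩ := hp.zigzag
    exact (coeffSylv_zigzagCoeff_ne_zero_iff _ _).2 ⟨⟨h1, h2⟩, h3⟩
  · rintro ⟨⟨r', hr'⟩, ⟨i', hi'⟩⟩ hne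
    obtain ⟨⟨h1, h2⟩, h3⟩ := (coeffSylv_zigzagCoeff_ne_zero_iff _ _).1 hne
    have hp' := hTJ r' i' hr'
    rcases hp'.eq_or_rank_lt (hT r' i' hr') (hT r i hr) hj h1 h3 with ⟨e1, e2⟩ | hlt
    · left
      rw [← e1, ← e2] at hp'
      obtain ⟨rfl, rfl⟩ : r' = r ∧ i' = i := by
        rcases hp with ⟨a, b, c⟩ | ⟨a, b, c⟩ <;> rcases hp' with ⟨a', b', c'⟩ | ⟨a', b', c'⟩ <;> lia
      rfl
    · exact Or.inr hlt

/-- The generic Sylvester matrix, with indeterminate coefficients. -/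
def genericSylv (F : Type*) [Field F] (p q d k : ℕ) :
    Matrix (Fin (k + d) × Fin p) (Fin k × Fin q)
      (MvPolynomial (Fin (d + 1) × Fin p × Fin q) F) :=
  coeffSylv d k fun l i j => if h : l < d + 1 then MvPolynomial.X (⟨l, h⟩, i, j) else 0

lemma genericSylv_map_eval {p q : ℕ} (d k : ℕ) (v : ℕ → Fin p → Fin q → F) :
    (genericSylv F p q d k).map (MvPolynomial.eval fun x => v x.1 x.2.1 x.2.2) =
      coeffSylv d k v := by
  rw [genericSylv, coeffSylv_map]
  ext r c
  simp only [coeffSylv]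
  refine if_ctx_congr Iff.rfl (fun h => ?_) fun _ => rfl
  rw [dif_pos (by lia), MvPolynomial.eval_X]

/-- Full-Sylvester-rank is implied by the non-vanishing of a nonzero polynomial in the
coefficients. -/
lemma exists_polynomial_hasFullSylvesterRank (F : Type*) [Field F] [Infinite F] {m n d : ℕ}
    (hn : 0 < n) :
    ∃ P : MvPolynomial (Fin (d + 1) × Fin m × Fin (m + n)) F,
      (∃ v, MvPolynomial.eval v P ≠ 0) ∧
      ∀ M : Matrix (Fin m) (Fin (m + n)) F[X],
        MvPolynomial.eval (fun x => (M x.2.1 x.2.2).coeff (x.1 : ℕ)) P ≠ 0 →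
          HasFullSylvesterRank d M := by
  set k := d * m / n with hk
  have hle : k * n ≤ d * m := Nat.div_mul_le_self _ _
  have hlt : d * m < (k + 1) * n := (Nat.div_lt_iff_lt_mul hn).1 (Nat.lt_succ_self _)
  obtain ⟨P, hP0, hP⟩ := exists_polynomial_colFull (genericSylv F m (m + n) d k) _ <| by
    rw [genericSylv_map_eval]
    exact colFull_zigzag (by nlinarith)
  obtain ⟨Q, hQ0, hQ⟩ := exists_polynomial_colFull (genericSylv F m (m + n) d (k + 1))ᵀ _ <| by
    rw [Matrix.transpose_map, genericSylv_map_eval]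
    exact colFull_zigzag_transpose (Nat.succ_pos k) (by nlinarith)
  refine ⟨P * Q, ?_, fun M hM l _ => ?_⟩
  · by_contra! h
    exact mul_ne_zero hP0 hQ0 (MvPolynomial.funext fun v => by rw [h, map_zero])
  · rw [map_mul] at hM
    rw [sylv_eq_coeffSylv]
    rcases le_or_gt l k with hlk | hlk
    · have h1 := hP _ (left_ne_zero_of_mul hM)
      rw [genericSylv_map_eval d k fun l i j => (M i j).coeff l] at h1
      rw [(colFull_coeffSylv_of_le hlk h1).rank_eq, min_eq_right]
      · simp
      · nlinarith [Nat.mul_le_mul_right n hlk]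
    · have h1 := hQ _ (right_ne_zero_of_mul hM)
      rw [Matrix.transpose_map, genericSylv_map_eval d (k + 1) fun l i j => (M i j).coeff l] at h1
      rw [← Matrix.rank_transpose,
        (colFull_coeffSylv_transpose_of_le (by lia) hlk h1).rank_eq, min_eq_left]
      · simp
      · nlinarith [Nat.mul_le_mul_right n hlk]

lemma exists_re_im_polynomial {σ : Type*} (P : MvPolynomial σ ℂ) :
    ∃ A B : MvPolynomial (σ ⊕ σ) ℝ, ∀ z : σ → ℂ,
      MvPolynomial.eval (Sum.elim (fun x => (z x).re) fun x => (z x).im) A =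
        (MvPolynomial.eval z P).re ∧
      MvPolynomial.eval (Sum.elim (fun x => (z x).re) fun x => (z x).im) B =
        (MvPolynomial.eval z P).im := by
  induction P using MvPolynomial.induction_on with
  | C a => exact ⟨MvPolynomial.C a.re, MvPolynomial.C a.im, by simp⟩
  | add p q hp hq =>
    obtain ⟨A, B, h⟩ := hp
    obtain ⟨A', B', h'⟩ := hq
    exact ⟨A + A', B + B', fun z => by simp [h z, h' z]⟩
  | mul_X p s hp =>
    obtain ⟨A, B, h⟩ := hp
    exact ⟨A * MvPolynomial.X (Sum.inl s) - B * MvPolynomial.X (Sum.inr s),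
      A * MvPolynomial.X (Sum.inr s) + B * MvPolynomial.X (Sum.inl s),
      fun z => by simp [h z]⟩

/-- Genericity of full-Sylvester-rank matrices over `ℝ` and over `ℂ`: identifying a
polynomial matrix of degree at most `d` with the tuple of the entries (resp. the real
and imaginary parts of the entries) of its coefficients `M_0, …, M_d`, the set of
matrices without full-Sylvester-rank is contained in the common zero set of finitely
many real multivariable polynomials that do not all vanish identically (hence that
zero set is a proper algebraic set, and the full-Sylvester-rank matrices form a
generic set). -/
theorem generic_hasFullSylvesterRank {m n d : ℕ} (hm : 0 < m) (hn : 0 < n)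
    (hd : 0 < d) :
    (∃ ps : Finset (MvPolynomial (Fin (d + 1) × Fin m × Fin (m + n)) ℝ),
      (∃ v : Fin (d + 1) × Fin m × Fin (m + n) → ℝ,
        ∃ p ∈ ps, MvPolynomial.eval v p ≠ 0) ∧
      ∀ M : Matrix (Fin m) (Fin (m + n)) ℝ[X], (∀ i j, (M i j).natDegree ≤ d) →
        ¬ HasFullSylvesterRank d M →
        ∀ p ∈ ps,
          MvPolynomial.eval (fun x => (M x.2.1 x.2.2).coeff (x.1 : ℕ)) p = 0) ∧
    (∃ ps : Finset (MvPolynomial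
        ((Fin (d + 1) × Fin m × Fin (m + n)) ⊕ (Fin (d + 1) × Fin m × Fin (m + n))) ℝ),
      (∃ v : (Fin (d + 1) × Fin m × Fin (m + n)) ⊕ (Fin (d + 1) × Fin m × Fin (m + n)) → ℝ,
        ∃ p ∈ ps, MvPolynomial.eval v p ≠ 0) ∧
      ∀ M : Matrix (Fin m) (Fin (m + n)) ℂ[X], (∀ i j, (M i j).natDegree ≤ d) →
        ¬ HasFullSylvesterRank d M →
        ∀ p ∈ ps,
          MvPolynomial.eval
            (Sum.elim (fun x => ((M x.2.1 x.2.2).coeff (x.1 : ℕ)).re)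
                      (fun x => ((M x.2.1 x.2.2).coeff (x.1 : ℕ)).im)) p = 0) := by
  refine ⟨?_, ?_⟩
  · obtain ⟨P, ⟨v, hv⟩, hP⟩ := exists_polynomial_hasFullSylvesterRank ℝ (m := m) (d := d) hn
    refine ⟨{P}, ⟨v, P, Finset.mem_singleton_self P, hv⟩, fun M _ hM p hp => ?_⟩
    rw [Finset.mem_singleton.1 hp]
    by_contra h
    exact hM (hP M h)
  · obtain ⟨P, ⟨v, hv⟩, hP⟩ := exists_polynomial_hasFullSylvesterRank ℂ (m := m) (d := d) hn
    obtain ⟨A, B, hAB⟩ := exists_re_im_polynomial P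
    classical
    refine ⟨{A, B}, ⟨Sum.elim (fun x => (v x).re) (fun x => (v x).im), ?_⟩,
      fun M _ hM p hp => ?_⟩
    · by_contra! h
      refine hv (Complex.ext ?_ ?_)
      · rw [← (hAB v).1, h A (by simp), Complex.zero_re]
      · rw [← (hAB v).2, h B (by simp), Complex.zero_im]
    · have h0 : MvPolynomial.eval (fun x => (M x.2.1 x.2.2).coeff (x.1 : ℕ)) P = 0 := by
        by_contra h
        exact hM (hP M h)
      have h1 := hAB fun x => (M x.2.1 x.2.2).coeff (x.1 : ℕ)
      rw [h0] at h1
      simp only [Finset.mem_insert, Finset.mem_singleton] at hp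
      rcases hp with rfl | rfl
      · exact h1.1
      · exact h1.2

end
end
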